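/- Let G be an elementary graph with elementary ordering (v1, …, vn) and n ≥ 2. Then: if n is even, vn is a pendant vertex of G; if n is odd, vn is an anti-pendant vertex of G; and (v1, …, v_{n−1}) is an elementary ordering of G − vn. Consequently, every elementary graph can be reduced to a single vertex by repeatedly deleting a pendant or anti-pendant vertex of the current graph. -/

import Mathlib

open SimpleGraph

/-- `(v 0, …, v (n-1))` is an elementary ordering of `G`: the earlier neighbourhood of the
`i`-th vertex (1-indexed) is `{v_1, …, v_{i-2}}` if `i` is odd and `{v_{i-1}}` if `i` is
even. (Here `k = i - 1` is the 0-indexed position, so `i` odd means `k` even.) -/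
def IsElemOrdering {V : Type*} (G : SimpleGraph V) (n : ℕ) (v : Fin n → V) : Prop :=
  Function.Bijective v ∧
  ∀ k j : Fin n, (j : ℕ) < (k : ℕ) →
    (G.Adj (v k) (v j) ↔
      if Even (k : ℕ) then (j : ℕ) + 1 < (k : ℕ) else (j : ℕ) + 1 = (k : ℕ))

/-- A pendant vertex: `N(x) = {u}` for some `u ≠ x`. -/
def IsPendantVert {W : Type*} (H : SimpleGraph W) (x : W) : Prop :=
  ∃ u, u ≠ x ∧ H.neighborSet x = {u}

/-- An anti-pendant vertex: `N[x] = V ∖ {u}` for some `u ≠ x`. -/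
def IsAntiPendantVert {W : Type*} (H : SimpleGraph W) (x : W) : Prop :=
  ∃ u, u ≠ x ∧ insert x (H.neighborSet x) = {u}ᶜ

/-- One step of pruning by pendant/anti-pendant vertices: delete from the current induced
subgraph `G[S]` a vertex that is pendant or anti-pendant in `G[S]`. -/
def PAStep {V : Type*} (G : SimpleGraph V) (S T : Set V) : Prop :=
  ∃ (x : V) (h : x ∈ S),
    (IsPendantVert (G.induce S) ⟨x, h⟩ ∨ IsAntiPendantVert (G.induce S) ⟨x, h⟩) ∧
    T = S \ {x}

/-- The last vertex of the prefix `v 0, …, v m` is pendant or anti-pendant in any induced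
subgraph `H` of `G` whose vertices are exactly that prefix. -/
theorem initial_pendant {V W : Type*} (G : SimpleGraph V) (H : SimpleGraph W) (f : W → V)
    (hf : Function.Injective f) (hadj : ∀ a b, H.Adj a b ↔ G.Adj (f a) (f b))
    (n : ℕ) (v : Fin n → V) (hv : IsElemOrdering G n v) (m : ℕ) (hm : m < n) (h1 : 1 ≤ m)
    (hr : ∀ i : Fin n, (∃ w, f w = v i) ↔ (i : ℕ) ≤ m) (x : W) (hx : f x = v ⟨m, hm⟩) :
    (Odd m → IsPendantVert H x) ∧ (Even m → IsAntiPendantVert H x) := by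
  obtain ⟨⟨hinj, hsurj⟩, hA⟩ := hv
  obtain ⟨u, hu⟩ := (hr ⟨m - 1, by omega⟩).2 (by simp)
  have key : ∀ w : W, ∃ i : Fin n, f w = v i ∧ (i : ℕ) ≤ m := by
    intro w
    obtain ⟨i, hi⟩ := hsurj (f w)
    exact ⟨i, hi.symm, (hr i).1 ⟨w, hi.symm⟩⟩
  have heq : ∀ (a b : W) (i j : Fin n), f a = v i → f b = v j → (a = b ↔ (i : ℕ) = j) := by
    intro a b i j ha hb
    rw [← hf.eq_iff, ha, hb, hinj.eq_iff, Fin.ext_iff]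
  have hux : u ≠ x := by
    intro h
    have := (heq u x _ _ hu hx).1 h
    simp at this
    omega
  constructor
  · intro hodd
    refine ⟨u, hux, ?_⟩
    ext w
    obtain ⟨i, hi, him⟩ := key w
    rw [SimpleGraph.mem_neighborSet, Set.mem_singleton_iff, heq w u _ _ hi hu, hadj, hx, hi]
    rcases Nat.lt_or_ge i m with h | h
    · rw [hA ⟨m, hm⟩ i h, if_neg (by simpa using hodd)]
      simp only
      omega
    · have : i = ⟨m, hm⟩ := Fin.ext (by simp; omega)
      subst this
      simp
      omega
  · intro heven
    refine ⟨u, hux, ?_⟩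
    ext w
    obtain ⟨i, hi, him⟩ := key w
    rw [Set.mem_insert_iff, SimpleGraph.mem_neighborSet, Set.mem_compl_iff,
      Set.mem_singleton_iff, heq w u _ _ hi hu, heq w x _ _ hi hx, hadj, hx, hi]
    rcases Nat.lt_or_ge i m with h | h
    · rw [hA ⟨m, hm⟩ i h, if_pos (by simpa using heven)]
      simp only
      omega
    · have : i = ⟨m, hm⟩ := Fin.ext (by simp; omega)
      subst this
      simp
      omega

theorem initial_reduce {V : Type*} (G : SimpleGraph V)
    (n : ℕ) (v : Fin n → V) (hv : IsElemOrdering G n v) (m : ℕ) (hm : m < n) :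
    Relation.ReflTransGen (PAStep G) (Set.image v {i | (i : ℕ) ≤ m}) {v ⟨0, by omega⟩} := by
  induction m with
  | zero =>
    have : Set.image v {i | (i : ℕ) ≤ 0} = {v ⟨0, by omega⟩} := by
      have h : {i : Fin n | (i : ℕ) ≤ 0} = {⟨0, by omega⟩} := by
        ext i
        simp [Fin.ext_iff]
      rw [h, Set.image_singleton]
    rw [this]
  | succ m ih =>
    refine Relation.ReflTransGen.head ?_ (ih (by omega))
    have hmem : v ⟨m + 1, hm⟩ ∈ Set.image v {i | (i : ℕ) ≤ m + 1} := ⟨_, by simp, rfl⟩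
    refine ⟨v ⟨m + 1, hm⟩, hmem, ?_, ?_⟩
    · have := initial_pendant G (G.induce (Set.image v {i | (i : ℕ) ≤ m + 1})) Subtype.val
        Subtype.val_injective (fun _ _ => Iff.rfl) n v hv (m + 1) hm (by omega)
        (by
          intro i
          constructor
          · rintro ⟨⟨w, j, hj, rfl⟩, h⟩
            have := hv.1.1 h
            subst this
            exact hj
          · intro h
            exact ⟨⟨v i, i, h, rfl⟩, rfl⟩)
        ⟨_, hmem⟩ rfl
      rcases Nat.even_or_odd (m + 1) with h | h
      · exact Or.inr (this.2 h)
      · exact Or.inl (this.1 h)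
    · ext w
      obtain ⟨i, rfl⟩ := hv.1.2 w
      simp only [Set.mem_sdiff, hv.1.1.mem_set_image, Set.mem_singleton_iff, hv.1.1.eq_iff,
        Set.mem_ofPred_eq, Fin.ext_iff]
      omega

/-- Let `G` be elementary with ordering `(v_1, …, v_n)`, `n ≥ 2`. Then `v_n` is pendant
if `n` is even and anti-pendant if `n` is odd; `(v_1, …, v_{n-1})` is an elementary
ordering of `G − v_n`; and consequently `G` can be reduced to a single vertex by
repeatedly deleting a pendant or anti-pendant vertex of the current graph. -/
theorem elementary_pruning {V : Type*} [Fintype V] (G : SimpleGraph V)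
    (n : ℕ) (hn : 2 ≤ n) (v : Fin n → V) (hv : IsElemOrdering G n v) :
    (Even n → IsPendantVert G (v ⟨n - 1, by omega⟩)) ∧
    (Odd n → IsAntiPendantVert G (v ⟨n - 1, by omega⟩)) ∧
    IsElemOrdering (G.induce {w : V | w ≠ v ⟨n - 1, by omega⟩}) (n - 1)
      (fun i => ⟨v ⟨(i : ℕ), i.isLt.trans_le (Nat.sub_le n 1)⟩, by
        intro hcontra
        have h2 := hv.1.1 hcontra
        have h3 : (i : ℕ) = n - 1 := by simpa [Fin.ext_iff] using h2
        have h4 := i.isLt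
        omega⟩) ∧
    (∃ x : V, Relation.ReflTransGen (PAStep G) Set.univ {x}) := by
  have main := initial_pendant G G id Function.injective_id (fun _ _ => Iff.rfl) n v hv (n - 1)
    (by omega) (by omega) (fun i => ⟨fun _ => by omega, fun _ => ⟨v i, rfl⟩⟩) _ rfl
  refine ⟨fun h => main.1 ?_, fun h => main.2 ?_, ⟨⟨?_, ?_⟩, ?_⟩, ?_⟩
  · exact Nat.Even.sub_odd (by omega) h odd_one
  · exact Nat.Odd.sub_odd h odd_one
  · intro i j hij
    have h := hv.1.1 (Subtype.ext_iff.1 hij)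
    simpa [Fin.ext_iff] using h
  · rintro ⟨w, hw⟩
    obtain ⟨i, rfl⟩ := hv.1.2 w
    have : (i : ℕ) ≠ n - 1 := fun h => hw (congrArg v (Fin.ext h))
    exact ⟨⟨i, by omega⟩, rfl⟩
  · intro k j hjk
    exact hv.2 ⟨k, by omega⟩ ⟨j, by omega⟩ hjk
  · refine ⟨v ⟨0, by omega⟩, ?_⟩
    have h := initial_reduce G n v hv (n - 1) (by omega)
    have hu : Set.image v {i | (i : ℕ) ≤ n - 1} = Set.univ := by
      refine Set.eq_univ_of_forall fun w => ?_
      obtain ⟨i, rfl⟩ := hv.1.2 w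
      exact ⟨i, by simp only [Set.mem_ofPred_eq]; omega, rfl⟩
    rwa [hu] at h
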